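/- Let τ ∈ ℝ be irrational and suppose the Schanuel condition holds for τ: for all n and all a ∈ (ℝ_{>0})^n, td_{ℚ(τ)}(a) + ldim_{ℚ(τ)}(a) ≥ ldim_ℚ(a). Let Γ be a divisible multiplicative subgroup of ℝ_{>0} with Γ contained in the algebraic closure of ℚ(τ), and let Δ be the ℚ(τ)-linear span of Γ inside the ℚ(τ)-vector space (ℝ_{>0},·). Then every non-degenerate solution in Δ^n of an equation a_1x_1+⋯+a_nx_n = 1 with coefficients a_i ∈ ℚ(τ) already lies in Γ^n. -/

import Mathlib

open Real

noncomputable section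

/-- The subfield ℚ(τ) of ℝ. -/
def Ktau (τ : ℝ) : Subfield ℝ := Subfield.closure {τ}

/-- Transcendence degree over a subfield K ⊆ ℝ of a finite tuple: the largest size of an
algebraically independent (over K) subfamily. -/
def tdeg (K : Subfield ℝ) {n : ℕ} (a : Fin n → ℝ) : ℕ :=
  sSup {k | ∃ s : Finset (Fin n), s.card = k ∧
    AlgebraicIndependent K (fun i : s => a i)}

/-- The dimension of the K-linear span of a tuple of positive reals in the K-vector
space (ℝ_{>0},·) (scalar action q · a = a^q): the largest size of a multiplicatively
K-independent subfamily. -/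
def mldim (K : Subfield ℝ) {n : ℕ} (a : Fin n → ℝ) : ℕ :=
  sSup {k | ∃ s : Finset (Fin n), s.card = k ∧
    ∀ c : Fin n → ℝ, (∀ i, c i ∈ K) → (∏ i ∈ s, a i ^ c i) = 1 → ∀ i ∈ s, c i = 0}

/-- The Schanuel condition for τ: td_{ℚ(τ)}(a) + ldim_{ℚ(τ)}(a) ≥ ldim_ℚ(a)
for all tuples a of positive reals.  (⊥ : Subfield ℝ) is the prime field ℚ. -/
def SchanuelCond (τ : ℝ) : Prop :=
  ∀ (n : ℕ) (a : Fin n → ℝ), (∀ i, 0 < a i) →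
    mldim (⊥ : Subfield ℝ) a ≤ tdeg (Ktau τ) a + mldim (Ktau τ) a

/-- A subset of ℝ which is a subgroup of the multiplicative group of positive reals. -/
def IsMulSubgroup (Γ : Set ℝ) : Prop :=
  (∀ g ∈ Γ, 0 < g) ∧ 1 ∈ Γ ∧ (∀ g ∈ Γ, ∀ h ∈ Γ, g * h ∈ Γ) ∧ ∀ g ∈ Γ, g⁻¹ ∈ Γ

/-- The K-linear span of Γ in the K-vector space (ℝ_{>0},·). -/
def MulSpan (K : Subfield ℝ) (Γ : Set ℝ) : Set ℝ :=
  {x : ℝ | ∃ (m : ℕ) (g : Fin m → ℝ) (c : Fin m → ℝ),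
    (∀ i, g i ∈ Γ) ∧ (∀ i, c i ∈ K) ∧ x = ∏ i, g i ^ c i}

lemma prod_exp_rpow {ι : Type*} (s : Finset ι) (x c : ι → ℝ) :
    ∏ i ∈ s, exp (x i) ^ c i = exp (∑ i ∈ s, c i * x i) := by
  rw [exp_sum]
  exact Finset.prod_congr rfl fun i _ ↦ by rw [← exp_mul, mul_comm]

lemma card_le_mldim_bot {n : ℕ} (x : Fin n → ℝ) (hx : LinearIndependent ℚ x) :
    n ≤ mldim ⊥ (fun i ↦ exp (x i)) := by
  refine le_csSup ⟨n, ?_⟩ ⟨Finset.univ, by simp, fun c hc h i _ ↦ ?_⟩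
  · rintro k ⟨s, rfl, -⟩
    simpa using s.card_le_univ
  · have hle : (⊥ : Subfield ℝ) ≤ (Rat.castHom ℝ).fieldRange := bot_le
    choose q hq using fun i ↦ hle (hc i)
    rw [prod_exp_rpow, exp_eq_one_iff] at h
    have := Fintype.linearIndependent_iff.mp hx q (by simpa [Rat.smul_def, ← hq] using h) i
    simp [← hq, this]

lemma mldim_exp_le (K : Subfield ℝ) {n : ℕ} (x : Fin n → ℝ) (T : Finset ℝ)
    (hT : ∀ i, x i ∈ Submodule.span K (T : Set ℝ)) :
    mldim K (fun i ↦ exp (x i)) ≤ T.card := by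
  refine csSup_le ⟨0, ∅, by simp⟩ ?_
  rintro k ⟨s, rfl, hs⟩
  have hli : LinearIndependent K (fun i : s ↦ x i) := by
    classical
    rw [Fintype.linearIndependent_iff]
    intro c hc i
    have h := hs (fun j ↦ if h : j ∈ s then (c ⟨j, h⟩ : ℝ) else 0)
      (fun j ↦ by split_ifs <;> simp) (by
        rw [prod_exp_rpow, exp_eq_one_iff, ← Finset.sum_coe_sort, ← hc]
        exact Finset.sum_congr rfl fun j _ ↦ by simp [Subfield.smul_def]) i i.2
    simpa using h
  simpa using linearIndependent_le_span_aux' _ hli (T : Set ℝ)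
    (by rintro _ ⟨i, rfl⟩; exact hT i)

lemma exists_algebraicIndependent_card_eq_tdeg (K : Subfield ℝ) {n : ℕ} (a : Fin n → ℝ) :
    ∃ s : Finset (Fin n), s.card = tdeg K a ∧ AlgebraicIndependent K (fun i : s ↦ a i) := by
  refine Nat.sSup_mem (s := {k | ∃ s : Finset (Fin n), s.card = k ∧
    AlgebraicIndependent K (fun i : s ↦ a i)}) ⟨0, ∅, by simp, ?_⟩ ⟨n, ?_⟩
  · exact algebraicIndependent_empty_type_iff.mpr (algebraMap K ℝ).injective
  · rintro k ⟨s, rfl, -⟩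
    simpa using s.card_le_univ

/-- The Schanuel condition for exponentials of a `ℚ`-linearly independent family contained in
the `K`-span of a finite set. -/
lemma SchanuelCond.exists_algebraicIndependent {τ : ℝ} (hSch : SchanuelCond τ) {ι : Type*}
    [Fintype ι] (x : ι → ℝ) (hx : LinearIndependent ℚ x) (T : Finset ℝ)
    (hT : ∀ i, x i ∈ Submodule.span (Ktau τ) (T : Set ℝ)) :
    ∃ s : Finset ι, Fintype.card ι ≤ s.card + T.card ∧
      AlgebraicIndependent (Ktau τ) (fun i : s ↦ exp (x i)) := by
  let e := (Fintype.equivFin ι).symm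
  have h := hSch _ (fun i ↦ exp (x (e i))) fun i ↦ exp_pos _
  obtain ⟨s, hs, hind⟩ :=
    exists_algebraicIndependent_card_eq_tdeg (Ktau τ) (fun i ↦ exp (x (e i)))
  have h₁ := card_le_mldim_bot (x ∘ e) (hx.comp e e.injective)
  have h₂ := mldim_exp_le (Ktau τ) (x ∘ e) T (fun i ↦ hT _)
  simp only [Function.comp_apply] at h₁ h₂
  refine ⟨s.map e.toEmbedding, by rw [Finset.card_map]; omega, ?_⟩
  have hmem (i : s.map e.toEmbedding) : e.symm i ∈ s := by
    obtain ⟨j, hj, hji⟩ := Finset.mem_map.mp i.2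
    simpa [← hji] using hj
  convert hind.comp (fun i : s.map e.toEmbedding ↦ (⟨e.symm i, hmem i⟩ : s))
    (fun i j hij ↦ Subtype.ext (e.symm.injective (congrArg Subtype.val hij))) using 2 with i
  simp

/-- Elements `w` that are `ℚ`-linearly independent modulo a `ℚ`-subspace `V` all of whose elements
have algebraic exponentials, and that lie in its `K`-span, have algebraically independent
exponentials. -/
lemma SchanuelCond.algebraicIndependent_exp {τ : ℝ} (hSch : SchanuelCond τ) (V : Submodule ℚ ℝ)
    (hV : ∀ v ∈ V, IsAlgebraic (Ktau τ) (exp v)) {p : ℕ} (w : Fin p → ℝ)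
    (hw : LinearIndependent ℚ (fun k ↦ V.mkQ (w k)))
    (hwV : ∀ k, w k ∈ Submodule.span (Ktau τ) (V : Set ℝ)) :
    AlgebraicIndependent (Ktau τ) (fun k ↦ exp (w k)) := by
  classical
  obtain ⟨B, hBV, hBspan, hB⟩ := exists_linearIndependent ℚ (V : Set ℝ)
  have hVB : Submodule.span (Ktau τ) (V : Set ℝ) ≤ Submodule.span (Ktau τ) B := by
    rw [Submodule.span_le]
    intro v hv
    have hv' : v ∈ Submodule.span ℚ B := hBspan ▸ Submodule.subset_span hv
    exact Submodule.span_subset_span ℚ (Ktau τ) B hv'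
  obtain ⟨T, hTB, hwT⟩ := Submodule.subset_span_finite_of_subset_span
    (R := Ktau τ) (s := B) (t := Finset.univ.image w) (by
      intro x hx
      obtain ⟨k, -, rfl⟩ := Finset.mem_image.mp (Finset.mem_coe.mp hx)
      exact hVB (hwV k))
  have hTV (v : T) : (v : ℝ) ∈ V := hBV (hTB v.2)
  have hTli : LinearIndependent ℚ (fun v : T ↦ (⟨v, hTV v⟩ : V)) :=
    .of_comp V.subtype (hB.comp (fun v : T ↦ (⟨v, hTB v.2⟩ : B))
      fun a b h ↦ Subtype.ext (congrArg (fun z : B ↦ (z : ℝ)) h))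
  obtain ⟨s, hs, hind⟩ := hSch.exists_algebraicIndependent _
    (hTli.sumElim_of_quotient w hw) T (by
      rintro (v | k)
      · exact Submodule.subset_span v.2
      · exact hwT (by simp))
  have hsub : s ⊆ Finset.univ.map Function.Embedding.inr := by
    rintro (v | k) h
    · exact absurd (hV v (hTV v)) (hind.transcendental ⟨_, h⟩)
    · simp
  have hs' : s = Finset.univ.map Function.Embedding.inr :=
    Finset.eq_of_subset_of_card_le hsub (by simp at hs ⊢; omega)
  exact hind.comp (fun k ↦ (⟨Sum.inr k, by simp [hs']⟩ : s)) fun a b h ↦ by simpa using h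

/-- Distinct Laurent monomials in algebraically independent elements are linearly independent. -/
lemma AlgebraicIndependent.sum_filter_eq_zero {F E ι σ : Type*} [Field F] [Field E] [Algebra F E]
    [Fintype ι] [Fintype σ] [DecidableEq (σ → ℤ)] {t : σ → E} (ht : AlgebraicIndependent F t)
    (b : ι → F) (e : ι → σ → ℤ)
    (h : ∑ i, algebraMap F E (b i) * ∏ k, t k ^ e i k = 0) (d : σ → ℤ) :
    ∑ i with e i = d, b i = 0 := by
  classical
  obtain ⟨N, hN, hdN⟩ : ∃ N : ℕ, (∀ i k, 0 ≤ e i k + N) ∧ ∀ k, 0 ≤ d k + N := by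
    refine ⟨∑ i, ∑ k, (e i k).natAbs + ∑ k, (d k).natAbs, fun i k ↦ ?_, fun k ↦ ?_⟩
    · have h₁ := Finset.single_le_sum (f := fun k ↦ (e i k).natAbs) (fun _ _ ↦ Nat.zero_le _)
        (Finset.mem_univ k)
      have h₂ := Finset.single_le_sum (f := fun i ↦ ∑ k, (e i k).natAbs)
        (fun _ _ ↦ Nat.zero_le _) (Finset.mem_univ i)
      omega
    · have h₁ := Finset.single_le_sum (f := fun k ↦ (d k).natAbs) (fun _ _ ↦ Nat.zero_le _)
        (Finset.mem_univ k)
      omega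
  let m (c : σ → ℤ) : σ →₀ ℕ := Finsupp.equivFunOnFinite.symm fun k ↦ (c k + N).toNat
  have hm (i : ι) : m (e i) = m d ↔ e i = d := by
    refine ⟨fun h ↦ funext fun k ↦ ?_, fun h ↦ by rw [h]⟩
    have hk : (e i k + N).toNat = (d k + N).toNat := by simpa [m] using DFunLike.congr_fun h k
    have := hN i k
    have := hdN k
    omega
  have ht0 (k : σ) : t k ≠ 0 := ht.ne_zero k
  have hP : MvPolynomial.aeval t (∑ i, MvPolynomial.monomial (m (e i)) (b i)) = 0 := by
    rw [map_sum, ← zero_mul (∏ k, t k ^ (N : ℤ)), ← h, Finset.sum_mul]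
    refine Finset.sum_congr rfl fun i _ ↦ ?_
    rw [MvPolynomial.aeval_monomial, Finsupp.prod_fintype _ _ (by simp), mul_assoc,
      ← Finset.prod_mul_distrib]
    congr 1
    refine Finset.prod_congr rfl fun k _ ↦ ?_
    rw [← zpow_add₀ (ht0 k), ← zpow_natCast]
    simp [m, Int.toNat_of_nonneg (hN i k)]
  have hcoeff := congrArg (MvPolynomial.coeff (m d)) (ht.eq_zero_of_aeval_eq_zero _ hP)
  simpa [MvPolynomial.coeff_sum, MvPolynomial.coeff_monomial, hm, Finset.sum_filter] using hcoeff

/-- The logarithms of a divisible subgroup of the positive reals, as a `ℚ`-vector space. -/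
def logSubmodule (Γ : Set ℝ) (hΓ : IsMulSubgroup Γ)
    (hdiv : ∀ g ∈ Γ, ∀ k : ℕ, 1 ≤ k → ∃ h ∈ Γ, h ^ k = g) : Submodule ℚ ℝ where
  carrier := {x | exp x ∈ Γ}
  zero_mem' := by simpa using hΓ.2.1
  add_mem' := fun {x y} hx hy ↦ by
    simpa [exp_add] using hΓ.2.2.1 _ hx _ hy
  smul_mem' := fun q x hx ↦ by
    obtain ⟨hpos, hone, hmul, hinv⟩ := hΓ
    obtain ⟨h, hh, hhx⟩ := hdiv _ hx q.den q.pos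
    have hpow (k : ℕ) : h ^ k ∈ Γ := by
      induction k with
      | zero => simpa using hone
      | succ k ih => rw [pow_succ]; exact hmul _ ih _ hh
    have hzpow (z : ℤ) : h ^ z ∈ Γ := by
      obtain ⟨k, rfl | rfl⟩ := z.eq_nat_or_neg
      · simpa using hpow k
      · simpa using hinv _ (hpow k)
    have hlog : (q.den : ℝ) * log h = x := by rw [← log_pow, hhx, log_exp]
    have hq : (q : ℝ) * x = q.num * log h := by
      have hden : (q.den : ℝ) ≠ 0 := by exact_mod_cast q.den_nz
      rw [← hlog]
      nth_rewrite 1 [Rat.cast_def]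
      field_simp
    have := hzpow q.num
    rw [Set.mem_ofPred_eq, Rat.smul_def, hq, ← log_zpow, exp_log (zpow_pos (hpos h hh) _)]
    exact this

/-- Finitely many vectors are, modulo a `ℚ`-subspace `V`, integer combinations of finitely many
elements of their span that are `ℚ`-linearly independent modulo `V`. -/
lemma exists_int_combination_mod {E ι : Type*} [AddCommGroup E] [Module ℚ E] [Finite ι]
    (V : Submodule ℚ E) (y : ι → E) :
    ∃ (p : ℕ) (w : Fin p → E) (z : ι → Fin p → ℤ),
      LinearIndependent ℚ (fun k ↦ V.mkQ (w k)) ∧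
      (∀ k, w k ∈ Submodule.span ℤ (Set.range y)) ∧
      ∀ i, y i - ∑ k, z i k • w k ∈ V := by
  let f : E →ₗ[ℤ] E ⧸ V := V.mkQ.restrictScalars ℤ
  let M : Submodule ℤ (E ⧸ V) := Submodule.span ℤ (Set.range (f ∘ y))
  have : Module.Finite ℤ M := Module.Finite.span_of_finite ℤ (Set.finite_range _)
  have : Module.IsTorsionFree ℤ (E ⧸ V) := Module.IsTorsionFree.trans_faithfulSMul ℤ ℚ (E ⧸ V)
  obtain ⟨p, B⟩ := Module.basisOfFiniteTypeTorsionFree' (R := ℤ) (M := M)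
  have hM : M = (Submodule.span ℤ (Set.range y)).map f := by
    rw [Submodule.map_span, ← Set.range_comp]
  have hB (k : Fin p) : ∃ w ∈ Submodule.span ℤ (Set.range y), f w = B k :=
    Submodule.mem_map.mp (hM ▸ (B k).2)
  choose w hw hwB using hB
  have hy (i : ι) : f (y i) ∈ M := Submodule.subset_span ⟨i, rfl⟩
  refine ⟨p, w, fun i k ↦ B.repr ⟨f (y i), hy i⟩ k, ?_, hw, fun i ↦ ?_⟩
  · rw [← LinearIndependent.iff_fractionRing ℤ ℚ]
    have := B.linearIndependent.map' M.subtype M.ker_subtype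
    have hcomp : (fun k ↦ V.mkQ (w k)) = M.subtype ∘ B := funext hwB
    rw [hcomp]
    exact this
  · rw [← Submodule.Quotient.mk_eq_zero]
    have h := congrArg M.subtype (B.sum_repr ⟨f (y i), hy i⟩)
    change f (y i - _) = 0
    rw [map_sub, map_sum, sub_eq_zero]
    simp only [map_sum, map_smul, Submodule.subtype_apply] at h
    simp only [map_smul, hwB]
    exact h.symm


/-- under the Schanuel condition, for a divisible Γ ≤ ℝ_{>0} with
Γ ⊆ ℚ(τ)^{alg} and Δ its ℚ(τ)-linear span, every non-degenerate solution in Δ^n of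
a_1x_1+⋯+a_nx_n = 1 with a_i ∈ ℚ(τ) lies in Γ^n. -/
theorem stmt7 (τ : ℝ) (hτ : Irrational τ) (hSch : SchanuelCond τ)
    (Γ : Set ℝ) (hΓ : IsMulSubgroup Γ)
    (hdiv : ∀ g ∈ Γ, ∀ k : ℕ, 1 ≤ k → ∃ h ∈ Γ, h ^ k = g)
    (halg : ∀ g ∈ Γ, IsAlgebraic (Ktau τ) g)
    (n : ℕ) (a g : Fin n → ℝ)
    (ha : ∀ i, a i ∈ Ktau τ) (hg : ∀ i, g i ∈ MulSpan (Ktau τ) Γ)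
    (heq : (∑ i, a i * g i) = 1)
    (hnd : ∀ I : Finset (Fin n), I.Nonempty → (∑ i ∈ I, a i * g i) ≠ 0) :
    ∀ i, g i ∈ Γ := by
  classical
  let K := Ktau τ
  let V := logSubmodule Γ hΓ hdiv
  have hpos (i : Fin n) : 0 < g i := by
    obtain ⟨m, γ, c, hγ, -, h⟩ := hg i
    rw [h]
    exact Finset.prod_pos fun j _ ↦ rpow_pos_of_pos (hΓ.1 _ (hγ j)) _
  have hlog (i : Fin n) : log (g i) ∈ Submodule.span K (V : Set ℝ) := by
    obtain ⟨m, γ, c, hγ, hc, h⟩ := hg i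
    have hγpos (j : Fin m) : 0 < γ j := hΓ.1 _ (hγ j)
    rw [h, log_prod fun j _ ↦ (rpow_pos_of_pos (hγpos j) _).ne']
    refine Submodule.sum_mem _ fun j _ ↦ ?_
    rw [log_rpow (hγpos j)]
    refine Submodule.smul_mem _ (⟨c j, hc j⟩ : K) (Submodule.subset_span ?_)
    change exp (log (γ j)) ∈ Γ
    rw [exp_log (hγpos j)]
    exact hγ j
  obtain ⟨p, w, z, hli, hw, hz⟩ := exists_int_combination_mod V fun i ↦ log (g i)
  have hind : AlgebraicIndependent K (fun k ↦ exp (w k)) := by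
    refine hSch.algebraicIndependent_exp V (fun v hv ↦ halg _ hv) w hli fun k ↦ ?_
    have hle : Submodule.span ℤ (Set.range fun i ↦ log (g i)) ≤
        (Submodule.span K (V : Set ℝ)).restrictScalars ℤ := by
      rw [Submodule.span_le]
      rintro _ ⟨i, rfl⟩
      exact hlog i
    exact hle (hw k)
  let γ (i : Fin n) : ℝ := exp (log (g i) - ∑ k, z i k • w k)
  have hγ (i : Fin n) : γ i ∈ Γ := hz i
  have hgγ (i : Fin n) : g i = γ i * ∏ k, exp (w k) ^ z i k := by
    have hprod : ∏ k, exp (w k) ^ z i k = exp (∑ k, z i k • w k) := by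
      rw [exp_sum]
      exact Finset.prod_congr rfl fun k _ ↦ by
        rw [← rpow_intCast, ← exp_mul, mul_comm, zsmul_eq_mul]
    rw [hprod, ← exp_add, sub_add_cancel, exp_log (hpos i)]
  let b (i : Fin n) : algebraicClosure K ℝ :=
    ⟨a i * γ i, mul_mem ((algebraicClosure K ℝ).algebraMap_mem ⟨a i, ha i⟩)
      (mem_algebraicClosure_iff.mpr (halg _ (hγ i)))⟩
  have hmon := hind.algebraicClosure.sum_filter_eq_zero
    (fun i : Option (Fin n) ↦ i.elim (-1) b) (fun i ↦ i.elim 0 z) (by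
      rw [Fintype.sum_option]
      have : ∑ i, a i * γ i * ∏ k, exp (w k) ^ z i k = 1 := by
        rw [← heq]
        exact Finset.sum_congr rfl fun i _ ↦ by rw [mul_assoc, ← hgγ]
      simpa [b, IntermediateField.algebraMap_apply, neg_add_eq_zero] using this.symm)
  intro i
  have hzi : z i = 0 := by
    by_contra hne
    have h : ∑ j, (if z j = z i then b j else 0) = 0 := by
      have h := hmon (z i)
      rw [Finset.sum_filter, Fintype.sum_option] at h
      simp only [Option.elim, Ne.symm hne, if_false, zero_add] at h
      exact h
    refine hnd {j | z j = z i} ⟨i, by simp⟩ ?_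
    have h' : ∑ j with z j = z i, a j * γ j = 0 := by
      have hL := congrArg (algebraMap (algebraicClosure K ℝ) ℝ) h
      rw [map_sum, map_zero] at hL
      rw [Finset.sum_filter]
      refine (Finset.sum_congr rfl fun j _ ↦ ?_).trans hL
      by_cases hj : z j = z i
      · rw [if_pos hj, if_pos hj]
        rfl
      · rw [if_neg hj, if_neg hj, map_zero]
    rw [← zero_mul (∏ k, exp (w k) ^ z i k), ← h', Finset.sum_mul]
    refine Finset.sum_congr rfl fun j hj ↦ ?_
    rw [hgγ j, (Finset.mem_filter.mp hj).2, mul_assoc]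
  rw [hgγ i, hzi]
  simpa using hγ i
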